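/- If 𝔟 < 𝔡, then there exists a nonmeager simple P-filter on ℕ. -/

import Mathlib

open Set Cardinal

/-- `A ⊆* B` : almost inclusion, i.e. `A \ B` is finite. -/
def AlmostSub (A B : Set ℕ) : Prop := (A \ B).Finite

/-- The Marczewski map: `mu u x = {n | x ∈ u n}`. -/
def mu {X : Type*} (u : ℕ → Set X) (x : X) : Set ℕ := {n | x ∈ u n}

/-- `u` is a γ-cover: every `mu u x` is cofinite. -/
def IsGammaCover {X : Type*} (u : ℕ → Set X) : Prop :=
  ∀ x : X, (mu u x)ᶜ.Finite

/-- `u` is an ω-cover: the family `mu u '' X` is centered. -/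
def IsOmegaCover {X : Type*} (u : ℕ → Set X) : Prop :=
  ∀ K : Finset X, (⋂ x ∈ K, mu u x).Infinite

/-- `u` is a τ-cover. -/
def IsTauCover {X : Type*} (u : ℕ → Set X) : Prop :=
  (∀ x : X, (mu u x).Infinite) ∧
  ∀ x₁ x₂ : X, AlmostSub (mu u x₁) (mu u x₂) ∨ AlmostSub (mu u x₂) (mu u x₁)

/-- A family of sets of naturals is linearly preordered by `⊆*`. -/
def LinearAlmost (J : Set (Set ℕ)) : Prop :=
  ∀ A ∈ J, ∀ B ∈ J, AlmostSub A B ∨ AlmostSub B A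

/-- `u` is a τ*-cover: some family `J` of infinite subsets of `ℕ`, linearly
preordered by `⊆*`, refines `mu u '' X`. -/
def IsTauAstCover {X : Type*} (u : ℕ → Set X) : Prop :=
  ∃ J : Set (Set ℕ), (∀ A ∈ J, A.Infinite) ∧ LinearAlmost J ∧
    ∀ x : X, ∃ A ∈ J, A ⊆ mu u x

/-- `u` is a τ⋆-cover: some family `J ⊆ mu u '' X` of infinite subsets of `ℕ`,
linearly preordered by `⊆*`, refines `mu u '' X`. -/
def IsTauStarCover {X : Type*} (u : ℕ → Set X) : Prop :=
  ∃ J : Set (Set ℕ), J ⊆ Set.range (mu u) ∧ (∀ A ∈ J, A.Infinite) ∧ LinearAlmost J ∧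
    ∀ x : X, ∃ A ∈ J, A ⊆ mu u x

/-- An open cover of the whole space. -/
def IsOpenCover {X : Type*} [TopologicalSpace X] (u : Set (Set X)) : Prop :=
  (∀ U ∈ u, IsOpen U) ∧ ⋃₀ u = Set.univ

/-- The selection principle `Ufin(O, P)` : for every sequence of open covers `u n`
there are finite `v n ⊆ u n` such that the sequence `n ↦ ⋃₀ v n` satisfies `P`. -/
def Ufin (X : Type*) [TopologicalSpace X] (P : (ℕ → Set X) → Prop) : Prop :=
  ∀ u : ℕ → Set (Set X), (∀ n, IsOpenCover (u n)) →
    ∃ v : ℕ → Set (Set X), (∀ n, (v n).Finite ∧ v n ⊆ u n) ∧ P (fun n => ⋃₀ v n)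

/-- The Menger property `Ufin(O,O)`. -/
def UfinO (X : Type*) [TopologicalSpace X] : Prop :=
  Ufin X (fun w => ∀ x : X, ∃ n, x ∈ w n)

/-- The Hurewicz property `Ufin(O,Γ)`. -/
def UfinGamma (X : Type*) [TopologicalSpace X] : Prop := Ufin X IsGammaCover

/-- `Ufin(O,Ω)`. -/
def UfinOmega (X : Type*) [TopologicalSpace X] : Prop := Ufin X IsOmegaCover

/-- `Ufin(O,T)`. -/
def UfinTau (X : Type*) [TopologicalSpace X] : Prop := Ufin X IsTauCover

/-- `Ufin(O,T*)`. -/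
def UfinTauAst (X : Type*) [TopologicalSpace X] : Prop := Ufin X IsTauAstCover

/-- `Ufin(O,T⋆)`. -/
def UfinTauStar (X : Type*) [TopologicalSpace X] : Prop := Ufin X IsTauStarCover

/-- The upward `⊆*`-closure of a family of subsets of `ℕ`. -/
def upCl (A : Set (Set ℕ)) : Set (Set ℕ) := {B | ∃ a ∈ A, AlmostSub a B}

/-- A semifilter on `ℕ`. -/
def IsSemifilter (F : Set (Set ℕ)) : Prop :=
  (∀ A ∈ F, A.Nonempty) ∧ ∀ A ∈ F, ∀ B : Set ℕ, AlmostSub A B → B ∈ F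

/-- A filter on `ℕ` (in the semifilter sense): a semifilter closed under finite
intersections. -/
def IsFilterFam (F : Set (Set ℕ)) : Prop :=
  IsSemifilter F ∧ ∀ A ∈ F, ∀ B ∈ F, A ∩ B ∈ F

/-- A simple P-filter: a filter consisting of infinite sets with a base linearly
preordered by `⊆*`. -/
def IsSimplePFilter (F : Set (Set ℕ)) : Prop :=
  IsFilterFam F ∧ (∀ A ∈ F, A.Infinite) ∧
  ∃ B : Set (Set ℕ), B ⊆ F ∧ F = upCl B ∧ LinearAlmost B

/-- A family of subsets of `ℕ` is meager if the corresponding set of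
characteristic functions is meager in the Cantor space `ℕ → Bool`. -/
def MeagerFam (F : Set (Set ℕ)) : Prop :=
  IsMeagre {f : ℕ → Bool | {n | f n = true} ∈ F}

/-- A family of subsets of `ℕ` is comeager if the corresponding set of
characteristic functions is comeager in the Cantor space `ℕ → Bool`. -/
def ComeagerFam (F : Set (Set ℕ)) : Prop :=
  {f : ℕ → Bool | {n | f n = true} ∈ F} ∈ residual (ℕ → Bool)

/-- `x ≤* y` : eventual dominance. -/
def evLE (x y : ℕ → ℕ) : Prop := {n | y n < x n}.Finite

/-- The unbounding number `𝔟`. -/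
noncomputable def cardB : Cardinal :=
  sInf {c | ∃ S : Set (ℕ → ℕ), c = #S ∧ ¬ ∃ y : ℕ → ℕ, ∀ x ∈ S, evLE x y}

/-- The dominating number `𝔡`. -/
noncomputable def cardD : Cardinal :=
  sInf {c | ∃ S : Set (ℕ → ℕ), c = #S ∧ ∀ x : ℕ → ℕ, ∃ y ∈ S, evLE x y}

/-- The ultrafilter number `𝔲`. -/
noncomputable def cardU : Cardinal :=
  sInf {c | ∃ (U : Ultrafilter ℕ) (B : Set (Set ℕ)), c = #B ∧
    (∀ A ∈ U, A.Infinite) ∧ (∀ b ∈ B, b ∈ U) ∧ ∀ A ∈ U, ∃ b ∈ B, b ⊆ A}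

/-- A groupwise dense family of infinite subsets of `ℕ`. -/
def IsGroupwiseDense (G : Set (Set ℕ)) : Prop :=
  (∀ A ∈ G, A.Infinite) ∧
  (∀ A ∈ G, ∀ B : Set ℕ, B.Infinite → B ⊆ A → B ∈ G) ∧
  ∀ k : ℕ → ℕ, StrictMono k →
    ∃ S : Set ℕ, S.Infinite ∧ (⋃ n ∈ S, Set.Ico (k n) (k (n + 1))) ∈ G

/-- The groupwise density number `𝔤`. -/
noncomputable def cardG : Cardinal :=
  sInf {c | ∃ 𝒢 : Set (Set (Set ℕ)), c = #𝒢 ∧ (∀ G ∈ 𝒢, IsGroupwiseDense G) ∧ ⋂₀ 𝒢 = ∅}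

/-- A tower of length `lam`: a `⊆*`-decreasing transfinite sequence of infinite
subsets of `ℕ` indexed by the ordinals below `lam`. -/
def IsTower (lam : Ordinal) (T : Ordinal → Set ℕ) : Prop :=
  (∀ α < lam, (T α).Infinite) ∧
  ∀ β α : Ordinal, β ≤ α → α < lam → AlmostSub (T α) (T β)

/-- `Depth⁺([ω]^{ℵ₀})`: the least cardinal `κ` such that there is no tower of
length `κ`. -/
noncomputable def depthPlus : Cardinal :=
  sInf {c : Cardinal | ¬ ∃ T : Ordinal → Set ℕ, IsTower c.ord T}

/-- The tower number `𝔱`: the least length of a tower with no infinite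
pseudo-intersection. -/
noncomputable def cardT : Cardinal :=
  sInf {c : Cardinal | ∃ T : Ordinal → Set ℕ, IsTower c.ord T ∧
    ¬ ∃ A : Set ℕ, A.Infinite ∧ ∀ α < c.ord, AlmostSub A (T α)}

/-- The trace of a family on the intervals determined by `k`. -/
def intervalTrace (k : ℕ → ℕ) (F : Set (Set ℕ)) : Set (Set ℕ) :=
  {S | ∃ A ∈ F, S = {n | (A ∩ Set.Ico (k n) (k (n + 1))).Nonempty}}

/-- The Filter Dichotomy principle. -/
def FilterDichotomy : Prop :=
  ∀ F U : Set (Set ℕ), IsFilterFam F → IsFilterFam U →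
    ¬ MeagerFam F → ¬ ComeagerFam F → ¬ MeagerFam U → ¬ ComeagerFam U →
    ∃ k : ℕ → ℕ, StrictMono k ∧ intervalTrace k F = intervalTrace k U

/-- `B` is `u`-bounded: `B` is contained in the union of a finite subfamily of `u`. -/
def BoundedBy {X : Type*} (u : Set (Set X)) (B : Set X) : Prop :=
  ∃ v : Set (Set X), v ⊆ u ∧ v.Finite ∧ B ⊆ ⋃₀ v

/-- The weak excluded middle property of a subset of the Baire space. -/
def WeakExcludedMiddle (Z : Set (ℕ → ℕ)) : Prop :=
  ∃ x : ℕ → ℕ, ∃ F : Set (Set ℕ), IsSimplePFilter F ∧ ∀ z ∈ Z, {n | z n ≤ x n} ∈ F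

/-- The set `{n | x n ≤ g n}`. -/
def leSet (g x : ℕ → ℕ) : Set ℕ := {n | x n ≤ g n}

theorem AlmostSub.trans {A B C : Set ℕ} (h : AlmostSub A B) (h' : AlmostSub B C) :
    AlmostSub A C := by
  refine (Set.Finite.union h h').subset ?_
  rintro n ⟨hA, hC⟩
  by_cases hB : n ∈ B
  · exact Or.inr ⟨hB, hC⟩
  · exact Or.inl ⟨hA, hB⟩

theorem AlmostSub.of_subset {A B : Set ℕ} (h : A ⊆ B) : AlmostSub A B := by
  rw [AlmostSub, Set.sdiff_eq_empty.2 h]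
  exact Set.finite_empty

theorem AlmostSub.inter {A B C : Set ℕ} (h : AlmostSub A B) (h' : AlmostSub A C) :
    AlmostSub A (B ∩ C) := by
  rw [AlmostSub, Set.sdiff_inter]
  exact Set.Finite.union h h'

theorem AlmostSub.infinite {A B : Set ℕ} (h : AlmostSub A B) (hA : A.Infinite) :
    B.Infinite := fun hB =>
  hA ((Set.Finite.union h hB).subset fun n hn => by
    by_cases hn' : n ∈ B
    · exact Or.inr hn'
    · exact Or.inl ⟨hn, hn'⟩)

theorem evLE.of_le {x y : ℕ → ℕ} (h : x ≤ y) : evLE x y := by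
  have : {n | y n < x n} = ∅ := Set.eq_empty_of_forall_notMem fun n hn => (h n).not_gt hn
  rw [evLE, this]
  exact Set.finite_empty

theorem evLE.trans {x y z : ℕ → ℕ} (h : evLE x y) (h' : evLE y z) : evLE x z := by
  refine (Set.Finite.union h h').subset fun n (hn : z n < x n) => ?_
  rcases lt_or_ge (y n) (x n) with h1 | h1
  · exact Or.inl h1
  · exact Or.inr (hn.trans_le h1)

theorem evLE.almostSub_leSet {x y : ℕ → ℕ} (h : evLE x y) (g : ℕ → ℕ) :
    AlmostSub (leSet g y) (leSet g x) := by
  refine Set.Finite.subset h fun n hn => ?_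
  have h1 : y n ≤ g n := hn.1
  have h2 : ¬ x n ≤ g n := hn.2
  exact h1.trans_lt (not_le.1 h2)

/-- The `⊆*`-upward closure of a `⊆*`-linear family of infinite sets is a simple P-filter. -/
theorem isSimplePFilter_upCl {B : Set (Set ℕ)} (hinf : ∀ A ∈ B, A.Infinite)
    (hlin : LinearAlmost B) : IsSimplePFilter (upCl B) := by
  have hup : ∀ A ∈ upCl B, A.Infinite := by
    rintro A ⟨a, ha, haA⟩
    exact haA.infinite (hinf a ha)
  refine ⟨⟨⟨fun A hA => (hup A hA).nonempty, ?_⟩, ?_⟩, hup,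
    B, fun A hA => ⟨A, hA, .of_subset Set.Subset.rfl⟩, rfl, hlin⟩
  · rintro A ⟨a, ha, haA⟩ C hAC
    exact ⟨a, ha, haA.trans hAC⟩
  · rintro A ⟨a, ha, haA⟩ C ⟨c, hc, hcC⟩
    rcases hlin a ha c hc with h | h
    · exact ⟨a, ha, haA.inter (h.trans hcC)⟩
    · exact ⟨c, hc, (h.trans haA).inter hcC⟩

theorem exists_evLE_bound {S : Set (ℕ → ℕ)} (h : #S < cardB) :
    ∃ y : ℕ → ℕ, ∀ x ∈ S, evLE x y := by
  by_contra hS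
  exact notMem_of_lt_csInf' h ⟨S, rfl, hS⟩

theorem exists_not_evLE {S : Set (ℕ → ℕ)} (h : #S < cardD) :
    ∃ x : ℕ → ℕ, ∀ y ∈ S, ¬ evLE x y := by
  by_contra! hS
  exact notMem_of_lt_csInf' h ⟨S, rfl, hS⟩

theorem exists_unbounded_mk_eq_cardB :
    ∃ S : Set (ℕ → ℕ), #S = cardB ∧ ¬ ∃ y : ℕ → ℕ, ∀ x ∈ S, evLE x y := by
  have hne : {c | ∃ S : Set (ℕ → ℕ), c = #S ∧ ¬ ∃ y : ℕ → ℕ, ∀ x ∈ S, evLE x y}.Nonempty := by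
    refine ⟨_, Set.univ, rfl, ?_⟩
    rintro ⟨y, hy⟩
    have := hy (fun n => y n + 1) (Set.mem_univ _)
    simp only [evLE, Nat.lt_succ_self, Set.ofPred_true] at this
    exact Set.infinite_univ this
  obtain ⟨S, hS, hS'⟩ := csInf_mem hne
  exact ⟨S, hS.symm, hS'⟩

/-- There is a `≤*`-linearly ordered, `≤*`-unbounded family of `𝔟` many monotone functions. -/
theorem exists_unbounded_chain :
    ∃ T : Set (ℕ → ℕ), #T ≤ cardB ∧ (∀ x ∈ T, Monotone x) ∧
      (∀ x ∈ T, ∀ y ∈ T, evLE x y ∨ evLE y x) ∧ ¬ ∃ y : ℕ → ℕ, ∀ x ∈ T, evLE x y := by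
  classical
  obtain ⟨S, hS, hunb⟩ := exists_unbounded_mk_eq_cardB
  obtain ⟨r, wo, hr⟩ := Cardinal.exists_ord_eq S
  have hbound : ∀ X : Set (ℕ → ℕ), ∃ y : ℕ → ℕ, #X < cardB → ∀ x ∈ X, evLE x y := fun X => by
    by_cases h : #X < cardB
    · obtain ⟨y, hy⟩ := exists_evLE_bound h
      exact ⟨y, fun _ => hy⟩
    · exact ⟨0, fun h' => absurd h' h⟩
  choose bd hbd using hbound
  let step : ∀ a : S, (∀ b : S, r b a → ℕ → ℕ) → ℕ → ℕ := fun a ih =>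
    partialSups (a.1 ⊔ bd (Set.range fun b : {b // r b a} => ih b.1 b.2))
  let f : S → ℕ → ℕ := wo.wf.fix step
  have hf : ∀ a, f a =
      partialSups (a.1 ⊔ bd (Set.range fun b : {b // r b a} => f b.1)) := fun a =>
    wo.wf.fix_eq step a
  have hself : ∀ a : S, a.1 ≤ f a := fun a => by
    rw [hf]
    exact le_sup_left.trans (le_partialSups _)
  have hlt : ∀ a b : S, r b a → evLE (f b) (f a) := fun a b hba => by
    have hcard : #(Set.range fun b : {b // r b a} => f b.1) < cardB := by
      refine mk_range_le.trans_lt ?_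
      rw [← hS]
      exact Cardinal.card_typein_lt a hr
    refine (hbd _ hcard (f b) ⟨⟨b, hba⟩, rfl⟩).trans (.of_le ?_)
    rw [hf a]
    exact le_sup_right.trans (le_partialSups _)
  refine ⟨Set.range f, hS ▸ mk_range_le, ?_, ?_, ?_⟩
  · rintro _ ⟨a, rfl⟩
    rw [hf]
    exact (partialSups _).monotone
  · rintro _ ⟨a, rfl⟩ _ ⟨b, rfl⟩
    rcases trichotomous_of r a b with h | rfl | h
    · exact Or.inl (hlt _ _ h)
    · exact Or.inl (.of_le le_rfl)
    · exact Or.inr (hlt _ _ h)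
  · rintro ⟨y, hy⟩
    exact hunb ⟨y, fun x hx => (evLE.of_le (hself ⟨x, hx⟩)).trans (hy _ ⟨_, rfl⟩)⟩

/-- Flipping the coordinates in a set, as a homeomorphism of the Cantor space. -/
def flipOn (t : Finset ℕ) : (ℕ → Bool) ≃ₜ (ℕ → Bool) where
  toFun x i := xor (decide (i ∈ t)) (x i)
  invFun x i := xor (decide (i ∈ t)) (x i)
  left_inv x := by ext i; simp
  right_inv x := by ext i; simp
  continuous_toFun := by fun_prop
  continuous_invFun := by fun_prop

theorem flipOn_apply (t : Finset ℕ) (x : ℕ → Bool) (i : ℕ) :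
    flipOn t x i = xor (decide (i ∈ t)) (x i) := rfl

theorem exists_agree_subset_of_isOpen {U : Set (ℕ → Bool)} (hU : IsOpen U) {s : ℕ → Bool}
    (hs : s ∈ U) : ∃ m : ℕ, ∀ x : ℕ → Bool, (∀ i < m, x i = s i) → x ∈ U := by
  obtain ⟨I, u, hu, hIU⟩ := isOpen_pi_iff.1 hU s hs
  refine ⟨I.sup id + 1, fun x hx => hIU fun i hi => ?_⟩
  rw [hx i (Nat.lt_succ_of_le (Finset.le_sup (f := id) hi))]
  exact (hu i hi).2

/-- A dense open subset of the Cantor space contains every point extending a suitable pattern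
on a finite interval with a prescribed left end. -/
theorem exists_pattern_of_dense {U : Set (ℕ → Bool)} (hU : IsOpen U) (hd : Dense U) (k : ℕ) :
    ∃ m > k, ∃ s : ℕ → Bool, ∀ x : ℕ → Bool, (∀ i ∈ Set.Ico k m, x i = s i) → x ∈ U := by
  let V : Set (ℕ → Bool) := ⋂ t ∈ (Finset.range k).powerset, flipOn t ⁻¹' U
  have hVo : IsOpen V := isOpen_biInter_finset fun t _ => hU.preimage (flipOn t).continuous
  have hVd : Dense V :=
    dense_biInter_of_isOpen (S := ((Finset.range k).powerset : Set (Finset ℕ)))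
      (fun t _ => hU.preimage (flipOn t).continuous) (Finset.countable_toSet _)
      (fun t _ => hd.preimage (flipOn t).isOpenMap)
  obtain ⟨s, hs⟩ := hVd.nonempty
  obtain ⟨m, hm⟩ := exists_agree_subset_of_isOpen hVo hs
  refine ⟨max m (k + 1), by omega, s, fun x hx => ?_⟩
  let t : Finset ℕ := {i ∈ Finset.range k | x i ≠ s i}
  have hxV : flipOn t x ∈ V := hm _ fun i hi => by
    by_cases hik : i < k
    · by_cases h : x i = s i
      · simp [flipOn_apply, t, h]
      · rw [flipOn_apply]
        have : i ∈ t := by simp [t, hik, h]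
        rw [decide_eq_true this]
        revert h
        cases x i <;> cases s i <;> simp
    · have := hx i ⟨not_lt.1 hik, hi.trans_le (le_max_left _ _)⟩
      simp [flipOn_apply, t, hik, this]
  have hxU := Set.mem_iInter₂.1 hxV t (Finset.mem_powerset.2 (Finset.filter_subset _ _))
  rwa [Set.mem_preimage, show flipOn t (flipOn t x) = x from (flipOn t).left_inv x] at hxU

/-- One direction of Talagrand's characterization of meager families closed under supersets. -/
theorem MeagerFam.exists_strictMono {F : Set (Set ℕ)} (hm : MeagerFam F)
    (hup : ∀ A ∈ F, ∀ B : Set ℕ, A ⊆ B → B ∈ F) :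
    ∃ k : ℕ → ℕ, StrictMono k ∧
      ∀ A ∈ F, {n | Disjoint A (Set.Ico (k n) (k (n + 1)))}.Finite := by
  classical
  obtain ⟨S, hSo, hSd, hSc, hSF⟩ := mem_residual_iff.1 hm
  obtain ⟨V, hV⟩ := (hSc.insert Set.univ).exists_eq_range (Set.insert_nonempty _ _)
  have hVS : ∀ n, V n = Set.univ ∨ V n ∈ S := fun n => by
    rw [← Set.mem_insert_iff, hV]
    exact ⟨n, rfl⟩
  have hVo : ∀ n, IsOpen (V n) := fun n => by
    rcases hVS n with h | h
    · rw [h]; exact isOpen_univ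
    · exact hSo _ h
  have hVd : ∀ n, Dense (V n) := fun n => by
    rcases hVS n with h | h
    · rw [h]; exact dense_univ
    · exact hSd _ h
  have hpat : ∀ n k : ℕ, ∃ m > k, ∃ s : ℕ → Bool, ∀ x : ℕ → Bool,
      (∀ i ∈ Set.Ico k m, x i = s i) → x ∈ ⋂ j ∈ Set.Iic n, V j := fun n k =>
    exists_pattern_of_dense ((Set.finite_Iic n).isOpen_biInter fun j _ => hVo j)
      (dense_biInter_of_isOpen (fun j _ => hVo j) (Set.to_countable _) fun j _ => hVd j) k
  choose m hmk s hs using hpat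
  obtain ⟨k, hkm⟩ : ∃ k : ℕ → ℕ, ∀ n, k (n + 1) = m n (k n) :=
    ⟨fun n => Nat.rec 0 m n, fun _ => rfl⟩
  have hk : StrictMono k := strictMono_nat_of_lt_succ fun n => hkm n ▸ hmk n (k n)
  refine ⟨k, hk, fun A hA => ?_⟩
  by_contra hinf
  let x : ℕ → Bool := fun i => decide (i ∈ A ∨ ∃ n : ℕ, Disjoint A (Set.Ico (k n) (k (n + 1))) ∧
    i ∈ Set.Ico (k n) (k (n + 1)) ∧ s n (k n) i = true)
  have hxF : {i | x i = true} ∈ F := hup A hA _ fun i hi => by simp [x, hi]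
  have hx : ∀ n, Disjoint A (Set.Ico (k n) (k (n + 1))) → x ∈ ⋂ j ∈ Set.Iic n, V j := by
    intro n hn
    refine hs n (k n) x fun i hi => ?_
    have hi' : i ∈ Set.Ico (k n) (k (n + 1)) := hkm n ▸ hi
    rw [Bool.eq_iff_iff, decide_eq_true_iff]
    constructor
    · rintro (h | ⟨n', -, hin', h⟩)
      · exact absurd hi' (Set.disjoint_left.1 hn h)
      · have h1 : n' < n + 1 := hk.lt_iff_lt.1 (hin'.1.trans_lt hi'.2)
        have h2 : n < n' + 1 := hk.lt_iff_lt.1 (hi'.1.trans_lt hin'.2)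
        obtain rfl : n' = n := by omega
        exact h
    · exact fun h => Or.inr ⟨n, hn, hi', h⟩
  refine hSF (fun t ht => ?_) hxF
  obtain ⟨j, rfl⟩ : t ∈ Set.range V := hV ▸ Set.mem_insert_of_mem _ ht
  obtain ⟨n, hn, hjn⟩ := Set.Infinite.exists_gt hinf j
  exact Set.mem_iInter₂.1 (hx n hn) j hjn.le

/-- If `𝔟 < 𝔡`, then there is a nonmeager simple P-filter. -/
theorem stmt_12 (h : cardB < cardD) :
    ∃ F : Set (Set ℕ), IsSimplePFilter F ∧ ¬ MeagerFam F := by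
  obtain ⟨T, hT, hmono, hlin, hunb⟩ := exists_unbounded_chain
  obtain ⟨g₀, hg₀⟩ := exists_not_evLE (hT.trans_lt h)
  obtain ⟨g, hg, hgg⟩ : ∃ g : ℕ → ℕ, Monotone g ∧ g₀ ≤ g :=
    ⟨partialSups g₀, (partialSups g₀).monotone, le_partialSups g₀⟩
  have hP : IsSimplePFilter (upCl (leSet g '' T)) := by
    refine isSimplePFilter_upCl ?_ ?_
    · rintro _ ⟨x, hx, rfl⟩ hfin
      exact hg₀ x hx (hfin.subset fun n (hn : x n < g₀ n) => hn.le.trans (hgg n))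
    · rintro _ ⟨x, hx, rfl⟩ _ ⟨y, hy, rfl⟩
      exact (hlin x hx y hy).symm.imp (·.almostSub_leSet g) (·.almostSub_leSet g)
  refine ⟨_, hP, fun hm => ?_⟩
  obtain ⟨k, hk, hkF⟩ := hm.exists_strictMono fun A hA B hAB => hP.1.1.2 A hA B (.of_subset hAB)
  refine hunb ⟨fun n => g (k (n + 1)), fun x hx => ?_⟩
  refine (hkF (leSet g x) ⟨_, ⟨x, hx, rfl⟩, .of_subset Set.Subset.rfl⟩).subset
    fun n (hn : g (k (n + 1)) < x n) => Set.disjoint_left.2 fun i (hi : x i ≤ g i) hik => ?_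
  have h1 : x n ≤ x i := hmono x hx ((hk.id_le n).trans hik.1)
  have h2 : g i ≤ g (k (n + 1)) := hg hik.2.le
  omega
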